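/- Lemma 1.2(a): Let B ∈ φ(V_D) and i ∈ Z/(D+1) with {i} ∈ B. Suppose I₂ ∈ B satisfies i ∈ I₂, I₂ ≠ {i}, and I₂ ⊆ J for every J ∈ B with i ∈ J and J ≠ {i}. Then i ∈ I₂^ev. -/

import Mathlib

open scoped BigOperators

/-- `W D` : functions `Z/(D+1) → F₂`. -/
abbrev Wsp (D : ℕ) : Type := ZMod (D + 1) → ZMod 2

/-- The all-ones function. -/
def allOnes (D : ℕ) : Wsp D := fun _ => 1

/-- `V D = W/span{u}`. -/
abbrev Vsp (D : ℕ) : Type := Wsp D ⧸ Submodule.span (ZMod 2) {allOnes D}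

/-- `e i` : image of the standard basis function at `i`. -/
def eV (D : ℕ) (i : ZMod (D + 1)) : Vsp D :=
  Submodule.Quotient.mk (Pi.single i 1)

/-- `e_I = ∑_{s ∈ I} e_s`. -/
def eSet (D : ℕ) (I : Finset (ZMod (D + 1))) : Vsp D := ∑ s ∈ I, eV D s

/-- A cyclic interval (arc): nonempty proper subset of the form `{i, i+1, …, j}`. -/
def IsInterval (D : ℕ) (I : Finset (ZMod (D + 1))) : Prop :=
  ∃ (i : ZMod (D + 1)) (l : ℕ), 1 ≤ l ∧ l ≤ D ∧
    I = (Finset.range l).image (fun t : ℕ => i + (t : ZMod (D + 1)))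

/-- Member of `ℐ¹` : interval of odd cardinality. -/
def OddInterval (D : ℕ) (I : Finset (ZMod (D + 1))) : Prop :=
  IsInterval D I ∧ Odd I.card

/-- `I ≺ I'` : `I ⊊ I'` and `I' − I` is a disjoint union of two intervals. -/
def Prec (D : ℕ) (I I' : Finset (ZMod (D + 1))) : Prop :=
  I ⊂ I' ∧ ∃ I₁ I₂, IsInterval D I₁ ∧ IsInterval D I₂ ∧ Disjoint I₁ I₂ ∧ I' \ I = I₁ ∪ I₂

/-- `I ♠ I'` : `I ∩ I' = ∅` and `I ∪ I'` is not an interval. -/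
def Spade (D : ℕ) (I I' : Finset (ZMod (D + 1))) : Prop :=
  I ∩ I' = ∅ ∧ ¬ IsInterval D (I ∪ I')

/-- `I^ev`. -/
noncomputable def evSet (D : ℕ) (I : Finset (ZMod (D + 1))) : Finset (ZMod (D + 1)) :=
  @Finset.filter _
    (fun i => ∃ I' I'', OddInterval D I' ∧ OddInterval D I'' ∧ Spade D I' I'' ∧
      I.erase i = I' ∪ I'')
    (Classical.decPred _) I

/-- `B ∈ φ(V_D)` : a finite set of elements of `ℐ¹` satisfying (P0) and (P1). -/
def phi (D : ℕ) (B : Finset (Finset (ZMod (D + 1)))) : Prop :=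
  (∀ I ∈ B, OddInterval D I) ∧
  (∀ I ∈ B, ∀ I' ∈ B, I = I' ∨ Spade D I I' ∨ Prec D I I' ∨ Prec D I' I) ∧
  (∀ I ∈ B, ∃ 𝒥 : Finset (Finset (ZMod (D + 1))), 𝒥 ⊆ B ∧
    (∀ J ∈ 𝒥, Prec D J I) ∧
    (∀ J ∈ 𝒥, ∀ J' ∈ 𝒥, J ≠ J' → Disjoint J J') ∧
    evSet D I ⊆ 𝒥.biUnion id)

/-- `⟨B⟩` : the F₂-span of `{e_I : I ∈ B}`. -/
def spanB (D : ℕ) (B : Finset (Finset (ZMod (D + 1)))) : Submodule (ZMod 2) (Vsp D) :=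
  Submodule.span (ZMod 2) (eSet D '' ↑B)

/-- `g_i(B) = |{I ∈ B : i ∈ I}|`. -/
def gB (D : ℕ) (B : Finset (Finset (ZMod (D + 1)))) (i : ZMod (D + 1)) : ℕ :=
  (B.filter (fun I => i ∈ I)).card

/-- `ε(B) = ∑_i (g_i(B)(g_i(B)+1)/2 mod 2) e_i`. -/
def epsB (D : ℕ) (B : Finset (Finset (ZMod (D + 1)))) : Vsp D :=
  ∑ i : ZMod (D + 1), ((gB D B i * (gB D B i + 1) / 2 : ℕ) : ZMod 2) • eV D i

/-- The partial order `B' ≤ B` on `φ(V_D)`. -/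
def leφ (D : ℕ) (B' B : Finset (Finset (ZMod (D + 1)))) : Prop :=
  ∃ (k : ℕ) (c : ℕ → Finset (Finset (ZMod (D + 1)))),
    c 0 = B' ∧ c k = B ∧ (∀ s ≤ k, phi D (c s)) ∧
    ∀ s < k, epsB D (c s) ∈ spanB D (c (s + 1))

/-- `B' < B`. -/
def ltφ (D : ℕ) (B' B : Finset (Finset (ZMod (D + 1)))) : Prop :=
  leφ D B' B ∧ B' ≠ B

/-- `1_E ∈ ℂ[V_D]`, the indicator function of `E ⊆ V_D`. -/
noncomputable def ind (D : ℕ) (E : Set (Vsp D)) : Vsp D → ℂ := E.indicator 1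

/-- `δ_x ∈ ℂ[V_D]`. -/
noncomputable def delta (D : ℕ) (x : Vsp D) : Vsp D → ℂ := ind D {x}

/-- The symplectic form on `W`. -/
def formW (D : ℕ) (x y : Wsp D) : ZMod 2 :=
  ∑ i : ZMod (D + 1), (x i * y (i + 1) + x (i + 1) * y i)

/-- The induced symplectic form on `V_D` (well defined since the form kills `u`). -/
noncomputable def formV (D : ℕ) (x y : Vsp D) : ZMod 2 :=
  formW D (Quotient.out x) (Quotient.out y)

/-- The Fourier transform `ℂ[V_D] → ℂ[V_D]`. -/
noncomputable def fourierV (D : ℕ) (f : Vsp D → ℂ) : Vsp D → ℂ :=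
  fun y => (2 : ℂ) ^ (-((D / 2 : ℕ) : ℤ)) *
    ∑ᶠ x : Vsp D, (if formV D x y = 0 then (1 : ℂ) else -1) * f x

/-- The target in `V_D` of the basis vector `e'_ℓ` of `V_{D-2}` under `τ_j`. -/
noncomputable def tauTgt (D j : ℕ) (ℓ : ZMod (D - 2 + 1)) : Vsp D :=
  let L : ℕ := if ℓ.val = 0 then D - 1 else ℓ.val
  if ℓ = ((j - 1 : ℕ) : ZMod (D - 2 + 1)) then
    eV D ((j : ZMod (D + 1)) - 1) + eV D (j : ZMod (D + 1)) + eV D ((j : ZMod (D + 1)) + 1)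
  else if L < j - 1 then eV D (L : ZMod (D + 1))
  else eV D ((L + 2 : ℕ) : ZMod (D + 1))

/-- The linear embedding `τ_j : V_{D-2} → V_D` (well defined independently of the chosen
representative since the targets sum to `0`). -/
noncomputable def tauMap (D j : ℕ) (x : Vsp (D - 2)) : Vsp D :=
  ∑ i : ZMod (D - 2 + 1), (Quotient.out x) i • tauTgt D j i

/-- The cyclic arc of length `l` starting at `a`. -/
def arc (D : ℕ) (a : ZMod (D + 1)) (l : ℕ) : Finset (ZMod (D + 1)) :=
  (Finset.range l).image (fun t : ℕ => a + (t : ZMod (D + 1)))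

theorem mem_arc {D : ℕ} {a x : ZMod (D + 1)} {l : ℕ} :
    x ∈ arc D a l ↔ ∃ t < l, a + (t : ZMod (D + 1)) = x := by
  simp [arc]

theorem add_natCast_inj {D : ℕ} {a : ZMod (D + 1)} {m n : ℕ} (hm : m ≤ D) (hn : n ≤ D) :
    a + (m : ZMod (D + 1)) = a + (n : ZMod (D + 1)) ↔ m = n := by
  rw [add_right_inj, ZMod.natCast_eq_natCast_iff', Nat.mod_eq_of_lt (by omega),
    Nat.mod_eq_of_lt (by omega)]

theorem add_natCast_mem_arc {D : ℕ} {a : ZMod (D + 1)} {m l : ℕ} (hm : m ≤ D) (hl : l ≤ D + 1) :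
    a + (m : ZMod (D + 1)) ∈ arc D a l ↔ m < l := by
  rw [mem_arc]
  constructor
  · rintro ⟨t, ht, h⟩
    rw [add_natCast_inj (by omega) hm] at h
    omega
  · exact fun h => ⟨m, h, rfl⟩

theorem card_arc {D : ℕ} (a : ZMod (D + 1)) {l : ℕ} (hl : l ≤ D + 1) : (arc D a l).card = l := by
  rw [arc, Finset.card_image_of_injOn, Finset.card_range]
  intro m hm n hn h
  simp only [Finset.coe_range, Set.mem_Iio] at hm hn
  exact (add_natCast_inj (by omega) (by omega)).1 h

theorem isInterval_arc {D : ℕ} (a : ZMod (D + 1)) {l : ℕ} (h1 : 1 ≤ l) (hl : l ≤ D) :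
    IsInterval D (arc D a l) :=
  ⟨a, l, h1, hl, rfl⟩

theorem oddInterval_arc {D : ℕ} (a : ZMod (D + 1)) {l : ℕ} (hodd : Odd l) (hl : l ≤ D) :
    OddInterval D (arc D a l) :=
  ⟨isInterval_arc a hodd.pos hl, by rwa [card_arc a (by omega)]⟩

theorem eq_start_of_mem_arc {D : ℕ} {a x : ZMod (D + 1)} {l : ℕ} (hx : x ∈ arc D a l)
    (hx' : x - 1 ∉ arc D a l) : x = a := by
  obtain ⟨t, ht, rfl⟩ := mem_arc.1 hx
  rcases t with _ | t
  · simp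
  · refine absurd (mem_arc.2 ⟨t, by omega, ?_⟩) hx'
    push_cast
    ring

theorem eq_end_of_mem_arc {D : ℕ} {a x : ZMod (D + 1)} {l : ℕ} (hx : x ∈ arc D a l)
    (hx' : x + 1 ∉ arc D a l) : x + 1 = a + l := by
  obtain ⟨t, ht, rfl⟩ := mem_arc.1 hx
  have htl : t + 1 = l := by
    by_contra hne
    exact hx' (mem_arc.2 ⟨t + 1, by omega, by push_cast; ring⟩)
  rw [← htl]
  push_cast
  ring

/-- An interval has at most one element whose predecessor lies outside it. -/
theorem IsInterval.start_unique {D : ℕ} {I : Finset (ZMod (D + 1))} (hI : IsInterval D I)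
    {x y : ZMod (D + 1)} (hx : x ∈ I) (hx' : x - 1 ∉ I) (hy : y ∈ I) (hy' : y - 1 ∉ I) :
    x = y := by
  obtain ⟨a, l, -, -, rfl⟩ := hI
  exact (eq_start_of_mem_arc hx hx').trans (eq_start_of_mem_arc hy hy').symm

theorem IsInterval.union_singleton {D : ℕ} {J : Finset (ZMod (D + 1))} (hJ : IsInterval D J)
    (hcard : J.card < D) {i : ZMod (D + 1)} (hi : i ∉ J) (hadj : i + 1 ∈ J ∨ i - 1 ∈ J) :
    IsInterval D (J ∪ {i}) := by
  obtain ⟨b, n, hn1, hnD, rfl⟩ := hJ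
  change (arc D b n).card < D at hcard
  change IsInterval D (arc D b n ∪ {i})
  change i ∉ arc D b n at hi
  change i + 1 ∈ arc D b n ∨ i - 1 ∈ arc D b n at hadj
  rw [card_arc b (by omega)] at hcard
  rcases hadj with h | h
  · have hb : i + 1 = b := eq_start_of_mem_arc h (by simpa using hi)
    subst hb
    refine ⟨i, n + 1, by omega, by omega, ?_⟩
    change _ = arc D i (n + 1)
    ext x
    simp only [Finset.mem_union, Finset.mem_singleton, mem_arc]
    constructor
    · rintro (⟨t, ht, rfl⟩ | rfl)
      · exact ⟨t + 1, by omega, by push_cast; ring⟩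
      · exact ⟨0, by omega, by simp⟩
    · rintro ⟨t, ht, rfl⟩
      rcases t with _ | t
      · right; simp
      · exact Or.inl ⟨t, by omega, by push_cast; ring⟩
  · have hb : i = b + n := by simpa using eq_end_of_mem_arc h (by simpa using hi)
    subst hb
    refine ⟨b, n + 1, by omega, by omega, ?_⟩
    change _ = arc D b (n + 1)
    ext x
    simp only [Finset.mem_union, Finset.mem_singleton, mem_arc]
    constructor
    · rintro (⟨t, ht, rfl⟩ | rfl)
      · exact ⟨t, by omega, rfl⟩
      · exact ⟨n, by omega, rfl⟩
    · rintro ⟨t, ht, rfl⟩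
      rcases Nat.lt_succ_iff_lt_or_eq.1 ht with h | rfl
      · exact Or.inl ⟨t, h, rfl⟩
      · exact Or.inr rfl

theorem arc_erase {D : ℕ} (a : ZMod (D + 1)) {l m : ℕ} (hl : l ≤ D) (hm : m < l) :
    (arc D a l).erase (a + m) = arc D a m ∪ arc D (a + (m + 1 : ℕ)) (l - m - 1) := by
  ext x
  simp only [Finset.mem_erase, Finset.mem_union, mem_arc]
  constructor
  · rintro ⟨hne, t, ht, rfl⟩
    rw [Ne, add_natCast_inj (by omega) (by omega)] at hne
    rcases Nat.lt_or_gt_of_ne hne with h | h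
    · exact Or.inl ⟨t, h, rfl⟩
    · refine Or.inr ⟨t - (m + 1), by omega, ?_⟩
      rw [add_assoc, ← Nat.cast_add, Nat.add_sub_cancel' h]
  · rintro (⟨t, ht, rfl⟩ | ⟨t, ht, rfl⟩)
    · refine ⟨?_, t, by omega, rfl⟩
      rw [Ne, add_natCast_inj (by omega) (by omega)]
      omega
    · rw [add_assoc, ← Nat.cast_add]
      refine ⟨?_, m + 1 + t, by omega, rfl⟩
      rw [Ne, add_natCast_inj (by omega) (by omega)]
      omega

theorem add_natCast_mem_evSet_arc {D : ℕ} (a : ZMod (D + 1)) {l m : ℕ} (hl : l ≤ D)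
    (hlodd : Odd l) (hm : m < l) (hmodd : Odd m) : a + (m : ZMod (D + 1)) ∈ evSet D (arc D a l) := by
  obtain ⟨k, rfl⟩ := hlodd
  obtain ⟨j, rfl⟩ := hmodd
  have herase := arc_erase a hl hm
  refine (@Finset.mem_filter _ _ (Classical.decPred _) _ _).2
    ⟨(add_natCast_mem_arc (by omega) (by omega)).2 hm, _, _,
    oddInterval_arc a ⟨j, rfl⟩ (by omega),
    oddInterval_arc _ ⟨k - j - 1, by omega⟩ (by omega), ⟨?_, ?_⟩, herase⟩
  · rw [← Finset.disjoint_iff_inter_eq_empty, Finset.disjoint_left]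
    intro x hx hx'
    obtain ⟨t, ht, rfl⟩ := mem_arc.1 hx
    obtain ⟨s, hs, h⟩ := mem_arc.1 hx'
    rw [add_assoc, ← Nat.cast_add, add_natCast_inj (by omega) (by omega)] at h
    omega
  · rw [← herase]
    intro hI
    have h := hI.start_unique (x := a) (y := a + (2 * j + 1 + 1 : ℕ)) ?_ ?_ ?_ ?_
    · have h' : a + ((0 : ℕ) : ZMod (D + 1)) = a + (2 * j + 1 + 1 : ℕ) := by simpa using h
      rw [add_natCast_inj (by omega) (by omega)] at h'
      omega
    · rw [herase]
      exact Finset.mem_union_left _ (mem_arc.2 ⟨0, by omega, by simp⟩)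
    · have hlast : a - 1 = a + (D : ZMod (D + 1)) := by
        have h0 : ((D + 1 : ℕ) : ZMod (D + 1)) = 0 := ZMod.natCast_self _
        push_cast at h0
        linear_combination -h0
      rw [hlast]
      intro hmem
      have := (add_natCast_mem_arc le_rfl (by omega)).1 (Finset.mem_of_mem_erase hmem)
      omega
    · rw [herase]
      exact Finset.mem_union_right _ (mem_arc.2 ⟨0, by omega, by simp⟩)
    · have hpred : a + ((2 * j + 1 + 1 : ℕ) : ZMod (D + 1)) - 1 = a + (2 * j + 1 : ℕ) := by
        push_cast
        ring
      rw [hpred]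
      exact Finset.notMem_erase _ _

/-- Lemma 1.2(a): if `{i} ∈ B` and `I₂` is the smallest element of `B` containing `i`
other than `{i}`, then `i ∈ I₂^ev`. -/
theorem lemma_1_2_a (D : ℕ) (hD : 2 ≤ D) (hDev : Even D)
    (B : Finset (Finset (ZMod (D + 1)))) (hB : phi D B) (i : ZMod (D + 1))
    (hi : {i} ∈ B) (I₂ : Finset (ZMod (D + 1))) (hI₂B : I₂ ∈ B) (hiI₂ : i ∈ I₂)
    (hne : I₂ ≠ {i}) (hmin : ∀ J ∈ B, i ∈ J → J ≠ {i} → I₂ ⊆ J) :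
    i ∈ evSet D I₂ := by
  obtain ⟨hodd, hP0, hP1⟩ := hB
  obtain ⟨⟨a, l, hl1, hlD, hI₂⟩, hl⟩ := hodd I₂ hI₂B
  change I₂ = arc D a l at hI₂
  subst hI₂
  rw [card_arc a (by omega)] at hl
  obtain ⟨m, hm, rfl⟩ := mem_arc.1 hiI₂
  by_contra hev
  have hmeven : Even m := by
    rw [← Nat.not_odd_iff_even]
    exact fun hmodd => hev (add_natCast_mem_evSet_arc a hlD hl hm hmodd)
  have hl3 : 3 ≤ l := by
    by_contra hlt
    obtain rfl : l = 1 := by obtain ⟨k, rfl⟩ := hl; omega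
    obtain rfl : m = 0 := by omega
    exact hne (by simp [arc])
  obtain ⟨y, hy, hadj⟩ : ∃ y ∈ evSet D (arc D a l),
      y ≠ a + (m : ZMod (D + 1)) ∧
        (y = a + (m : ZMod (D + 1)) + 1 ∨ y = a + (m : ZMod (D + 1)) - 1) := by
    rcases m with _ | m
    · refine ⟨_, add_natCast_mem_evSet_arc a hlD hl (by omega) odd_one, ?_, by simp⟩
      rw [Ne, add_natCast_inj (by omega) (by omega)]
      omega
    · refine ⟨_, add_natCast_mem_evSet_arc a hlD hl (m := m) (by omega) (by grind), ?_,
        Or.inr (by push_cast; ring)⟩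
      rw [Ne, add_natCast_inj (by omega) (by omega)]
      omega
  obtain ⟨𝒥, h𝒥B, h𝒥prec, -, hcover⟩ := hP1 _ hI₂B
  obtain ⟨J, hJ, hyJ⟩ := Finset.mem_biUnion.1 (hcover hy)
  rw [id] at hyJ
  have hJI := (h𝒥prec J hJ).1
  have hiJ : a + (m : ZMod (D + 1)) ∉ J := fun hmem =>
    hJI.2 (hmin J (h𝒥B hJ) hmem fun h => hadj.1 (Finset.mem_singleton.1 (h ▸ hyJ)))
  have hcard : J.card < D := by
    have := Finset.card_lt_card hJI
    rw [card_arc a (by omega)] at this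
    omega
  have hunion : IsInterval D (J ∪ {a + (m : ZMod (D + 1))}) := by
    refine (hodd J (h𝒥B hJ)).1.union_singleton hcard hiJ ?_
    rcases hadj.2 with rfl | rfl
    · exact Or.inl hyJ
    · exact Or.inr hyJ
  rcases hP0 J (h𝒥B hJ) _ hi with h | h | h | h
  · exact hiJ (by rw [h]; exact Finset.mem_singleton_self _)
  · exact h.2 hunion
  · exact hadj.1 (Finset.mem_singleton.1 (h.1.1 hyJ))
  · exact hiJ (h.1.1 (Finset.mem_singleton_self _))
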